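/- (BLADES regret gap lower bound) There is a universal constant c > 0 such that for all integers u ≥ 2 and horizons H ≥ u, and all ε > 0 with ε·H ≤ 1/4, there exist a finite Markov Game with horizon H, complete deviation classes Φ, an expert policy σ_E satisfying u-recoverability, and a learner policy σ with BLADES loss ℓ_BLADES(σ) = max_{i∈[m]} max_{φ_i∈Φ_i} E_{s∼d^{π_{σ,φ_i}}}[ℓ_TV(σ_E(s), σ(s))] ≤ ε, such that the regret gap satisfies R_Φ(σ) − R_Φ(σ_E) ≥ c·ε·u·H. -/

import Mathlib

open scoped Classical

noncomputable section

namespace MAIL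

/-- A finite Markov Game: horizon `H`, transition kernel `T`, per-agent rewards `r`,
and initial state distribution `ρ₀`.  The agents are indexed by `Fin m`, the state
space is `S`, and agent `i` has action space `A i`; a joint action is an element of
`∀ i, A i`. -/
structure MG (m : ℕ) (S : Type) (A : Fin m → Type) where
  H : ℕ
  T : S → (∀ i, A i) → S → ℝ
  r : Fin m → S → (∀ i, A i) → ℝ
  ρ₀ : S → ℝ

variable {m : ℕ} {S : Type} {A : Fin m → Type} [Fintype S] [∀ i, Fintype (A i)]

/-- The Markov game data is valid: `ρ₀` and each `T s a` are probability
distributions, and all rewards take values in `[-1, 1]`. -/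
def IsMG (G : MG m S A) : Prop :=
  (∀ s, 0 ≤ G.ρ₀ s) ∧ (∑ s, G.ρ₀ s) = 1 ∧
  (∀ s a, (∀ s', 0 ≤ G.T s a s') ∧ (∑ s', G.T s a s') = 1) ∧
  (∀ i s a, |G.r i s a| ≤ 1)

/-- A (mediator or joint) policy is a stochastic map from states to joint actions.
When all agents obediently follow the mediator policy `σ`, the induced joint policy
`π_σ` is `σ` itself. -/
def IsPolicy (π : S → (∀ i, A i) → ℝ) : Prop :=
  ∀ s, (∀ a, 0 ≤ π s a) ∧ (∑ a, π s a) = 1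

/-- Distribution over states at (0-indexed) step `h` under joint policy `π`. -/
def stateDist (G : MG m S A) (π : S → (∀ i, A i) → ℝ) : ℕ → S → ℝ
  | 0 => G.ρ₀
  | h + 1 => fun s' => ∑ s, ∑ a, stateDist G π h s * π s a * G.T s a s'

/-- Expected cumulative reward over horizon `G.H` of joint policy `π` when every
agent's reward function is `f`, i.e. `J(π, f)`. -/
def Jf (G : MG m S A) (π : S → (∀ i, A i) → ℝ) (f : S → (∀ i, A i) → ℝ) : ℝ :=
  ∑ h ∈ Finset.range G.H, ∑ s, ∑ a, stateDist G π h s * π s a * f s a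

/-- Value `J_i(π)` of joint policy `π` for agent `i` under the true rewards. -/
def J (G : MG m S A) (i : Fin m) (π : S → (∀ i, A i) → ℝ) : ℝ :=
  Jf G π (G.r i)

/-- Occupancy measure `ρ^π(s, a) = (1/H) ∑_h Pr_π(s_h = s, a_h = a)`. -/
def occ (G : MG m S A) (π : S → (∀ i, A i) → ℝ) (s : S) (a : ∀ i, A i) : ℝ :=
  (∑ h ∈ Finset.range G.H, stateDist G π h s * π s a) / G.H

/-- Average state visitation distribution `d^π(s) = ∑_a ρ^π(s, a)`. -/
def dAvg (G : MG m S A) (π : S → (∀ i, A i) → ℝ) (s : S) : ℝ :=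
  ∑ a, occ G π s a

/-- The joint policy `π_{σ, φ_i}` obtained from mediator policy `σ` when agent `i`
deviates via `φ : S → A i → A i` (playing `φ s a` when recommended `a` at state `s`)
while all other agents follow their recommendations. -/
def dev (σ : S → (∀ i, A i) → ℝ) (i : Fin m) (φ : S → A i → A i) :
    S → (∀ i, A i) → ℝ :=
  fun s b => ∑ a : ∀ j, A j, if Function.update a i (φ s (a i)) = b then σ s a else 0

/-- Regret `R_Φ(σ, f)` of mediator policy `σ` w.r.t. deviation classes `Φ`, when
`f` is used as every agent's reward function. -/
def regretF (G : MG m S A) (σ : S → (∀ i, A i) → ℝ)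
    (Φ : ∀ i : Fin m, Set (S → A i → A i)) (f : S → (∀ i, A i) → ℝ) : ℝ :=
  ⨆ i : Fin m, ⨆ φ : Φ i, (Jf G (dev σ i φ.1) f - Jf G σ f)

/-- Regret `R_Φ(σ)` of mediator policy `σ` under the true rewards. -/
def regret (G : MG m S A) (σ : S → (∀ i, A i) → ℝ)
    (Φ : ∀ i : Fin m, Set (S → A i → A i)) : ℝ :=
  ⨆ i : Fin m, ⨆ φ : Φ i, (J G i (dev σ i φ.1) - J G i σ)

/-- Value-to-go `V` of joint policy `π` with `k` steps remaining (so the value from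
step `h` in the paper corresponds to `k = H - h` remaining steps), with every
agent's reward given by `f`. -/
def Vgo (G : MG m S A) (f : S → (∀ i, A i) → ℝ) (π : S → (∀ i, A i) → ℝ) :
    ℕ → S → ℝ
  | 0 => fun _ => 0
  | k + 1 => fun s => ∑ a, π s a * (f s a + ∑ s', G.T s a s' * Vgo G f π k s')

/-- Q-value of joint policy `π` with `k` steps remaining. -/
def Qgo (G : MG m S A) (f : S → (∀ i, A i) → ℝ) (π : S → (∀ i, A i) → ℝ)
    (k : ℕ) (s : S) (a : ∀ i, A i) : ℝ :=
  match k with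
  | 0 => 0
  | k + 1 => f s a + ∑ s', G.T s a s' * Vgo G f π k s'

/-- Advantage `A = Q - V` of joint policy `π` with `k` steps remaining. -/
def Adv (G : MG m S A) (f : S → (∀ i, A i) → ℝ) (π : S → (∀ i, A i) → ℝ)
    (k : ℕ) (s : S) (a : ∀ i, A i) : ℝ :=
  Qgo G f π k s a - Vgo G f π k s

/-- `u`-recoverability: the advantage of any expert-plus-single-deviation joint
policy `π_{σ_E, φ_i}` is bounded by `u` at every state, joint action, and step. -/
def Recoverable (G : MG m S A) (Φ : ∀ i : Fin m, Set (S → A i → A i))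
    (σE : S → (∀ i, A i) → ℝ) (u : ℝ) : Prop :=
  ∀ i : Fin m, ∀ φ ∈ Φ i, ∀ k ≤ G.H, ∀ s a, |Adv G (G.r i) (dev σE i φ) k s a| ≤ u

/-- `β`-coverage: the expert's average state distribution puts mass at least `β`
on every state. -/
def Coverage (G : MG m S A) (σE : S → (∀ i, A i) → ℝ) (β : ℝ) : Prop :=
  ∀ s, β ≤ dAvg G σE s

/-- Total variation distance between two finitely supported distributions. -/
def tv {α : Type} [Fintype α] (p q : α → ℝ) : ℝ :=
  (∑ a, |p a - q a|) / 2

section Policies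

set_option linter.unusedSectionVars false in
lemma IsPolicy.dev {σ : S → (∀ i, A i) → ℝ} (hσ : IsPolicy σ) (i : Fin m)
    (φ : S → A i → A i) : IsPolicy (dev σ i φ) := by
  refine fun s => ⟨fun b => Finset.sum_nonneg fun a _ => ?_, ?_⟩
  · split_ifs
    exacts [(hσ s).1 a, le_rfl]
  · unfold MAIL.dev
    rw [Finset.sum_comm]
    simpa using (hσ s).2

lemma stateDist_nonneg {G : MG m S A} (hG : IsMG G) {π : S → (∀ i, A i) → ℝ}
    (hπ : IsPolicy π) (h : ℕ) (s : S) : 0 ≤ stateDist G π h s := by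
  induction h generalizing s with
  | zero => exact hG.1 s
  | succ h ih =>
    exact Finset.sum_nonneg fun t _ => Finset.sum_nonneg fun a _ =>
      mul_nonneg (mul_nonneg (ih t) ((hπ t).1 a)) ((hG.2.2.1 t a).1 s)

lemma sum_stateDist {G : MG m S A} (hG : IsMG G) {π : S → (∀ i, A i) → ℝ}
    (hπ : IsPolicy π) (h : ℕ) : ∑ s, stateDist G π h s = 1 := by
  induction h with
  | zero => exact hG.2.1
  | succ h ih =>
    simp only [stateDist]
    rw [Finset.sum_comm, ← ih]
    refine Finset.sum_congr rfl fun t _ => ?_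
    rw [Finset.sum_comm]
    simp only [← Finset.mul_sum, (hG.2.2.1 t _).2, mul_one, (hπ t).2]

lemma dAvg_eq (G : MG m S A) {π : S → (∀ i, A i) → ℝ} (hπ : IsPolicy π) (s : S) :
    dAvg G π s = (∑ h ∈ Finset.range G.H, stateDist G π h s) / G.H := by
  unfold dAvg occ
  rw [← Finset.sum_div, Finset.sum_comm]
  simp only [← Finset.mul_sum, (hπ s).2, mul_one]

lemma sum_dAvg {G : MG m S A} (hG : IsMG G) (hH : G.H ≠ 0) {π : S → (∀ i, A i) → ℝ}
    (hπ : IsPolicy π) : ∑ s, dAvg G π s = 1 := by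
  simp only [dAvg_eq G hπ]
  rw [← Finset.sum_div, Finset.sum_comm]
  simp only [sum_stateDist hG hπ]
  simp [hH]

end Policies

section SlowRecovery

lemma sum_jointAction (f : (Fin 1 → Fin 2) → ℝ) :
    ∑ a, f a = f (fun _ => 0) + f (fun _ => 1) := by
  rw [← (Equiv.funUnique (Fin 1) (Fin 2)).symm.sum_comp, Fin.sum_univ_two]
  rfl

/-- The one-agent game with a good state `0`, which pays `1`, and a bad state `1`, which pays
nothing. In the good state the action selects the next state; from the bad state the good one is
reached with probability `p`, whatever the action. -/
def slowRecovery (H : ℕ) (p : ℝ) : MG 1 (Fin 2) (fun _ => Fin 2) where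
  H := H
  T s a s' := if s = 0 then (if s' = a 0 then 1 else 0) else (if s' = 0 then p else 1 - p)
  r _ s _ := if s = 0 then 1 else 0
  ρ₀ s := if s = 0 then 1 else 0

lemma slowRecovery_T (H : ℕ) (p : ℝ) (s : Fin 2) (a : Fin 1 → Fin 2) (s' : Fin 2) :
    (slowRecovery H p).T s a s' =
      if s = 0 then (if s' = a 0 then 1 else 0) else (if s' = 0 then p else 1 - p) := rfl

lemma slowRecovery_r (H : ℕ) (p : ℝ) (i : Fin 1) (s : Fin 2) (a : Fin 1 → Fin 2) :
    (slowRecovery H p).r i s a = if s = 0 then 1 else 0 := rfl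

/-- The policy that plays action `1` with probability `e` in every state. -/
def errPolicy (e : ℝ) : Fin 2 → (Fin 1 → Fin 2) → ℝ :=
  fun _ a => if a 0 = 0 then 1 - e else e

lemma isMG_slowRecovery (H : ℕ) {p : ℝ} (h0 : 0 ≤ p) (h1 : p ≤ 1) :
    IsMG (slowRecovery H p) := by
  refine ⟨fun s => ?_, by simp [slowRecovery], fun s a => ⟨fun s' => ?_, ?_⟩, fun i s a => ?_⟩
  · simp only [slowRecovery]
    split_ifs <;> norm_num
  · simp only [slowRecovery]
    split_ifs <;> linarith
  · by_cases hs : s = 0 <;> simp [slowRecovery, hs]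
  · simp only [slowRecovery]
    split_ifs <;> norm_num

lemma isPolicy_errPolicy {e : ℝ} (h0 : 0 ≤ e) (h1 : e ≤ 1) : IsPolicy (errPolicy e) := by
  refine fun s => ⟨fun a => ?_, by rw [sum_jointAction]; simp [errPolicy]⟩
  simp only [errPolicy]
  split_ifs <;> linarith

lemma tv_errPolicy {e : ℝ} (h0 : 0 ≤ e) (s : Fin 2) :
    tv (errPolicy 0 s) (errPolicy e s) = e := by
  unfold tv
  rw [sum_jointAction]
  simp [errPolicy, abs_of_nonneg h0]

lemma sum_policy {π : Fin 2 → (Fin 1 → Fin 2) → ℝ} (hπ : IsPolicy (A := fun _ => Fin 2) π)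
    (s : Fin 2) : π s (fun _ => 0) + π s (fun _ => 1) = 1 := by
  rw [← sum_jointAction]
  exact (hπ s).2

lemma J_slowRecovery (H : ℕ) (p : ℝ) {π : Fin 2 → (Fin 1 → Fin 2) → ℝ}
    (hπ : IsPolicy (A := fun _ => Fin 2) π) :
    J (slowRecovery H p) 0 π = ∑ h ∈ Finset.range H, stateDist (slowRecovery H p) π h 0 := by
  unfold J Jf
  refine Finset.sum_congr rfl fun h _ => ?_
  rw [Fin.sum_univ_two, sum_jointAction, sum_jointAction]
  simp only [slowRecovery_r, if_true, one_ne_zero, if_false, mul_one, mul_zero, add_zero]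
  rw [← mul_add, sum_policy hπ, mul_one]

lemma stateDist_slowRecovery_succ (H : ℕ) (p : ℝ) {π : Fin 2 → (Fin 1 → Fin 2) → ℝ}
    (hπ : IsPolicy (A := fun _ => Fin 2) π) (h : ℕ) :
    stateDist (slowRecovery H p) π (h + 1) 1 =
      stateDist (slowRecovery H p) π h 0 * π 0 (fun _ => 1) +
        (1 - p) * stateDist (slowRecovery H p) π h 1 := by
  rw [stateDist]
  beta_reduce
  rw [Fin.sum_univ_two, sum_jointAction, sum_jointAction]
  have := sum_policy hπ 1
  simp only [slowRecovery_T, if_true, one_ne_zero, if_false, mul_one, mul_zero, zero_add]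
  linear_combination (1 - p) * stateDist (slowRecovery H p) π h 1 * this

lemma stateDist_zero_eq {H : ℕ} {p : ℝ} (h0 : 0 ≤ p) (h1 : p ≤ 1)
    {π : Fin 2 → (Fin 1 → Fin 2) → ℝ} (hπ : IsPolicy (A := fun _ => Fin 2) π) (h : ℕ) :
    stateDist (slowRecovery H p) π h 0 = 1 - stateDist (slowRecovery H p) π h 1 := by
  have := sum_stateDist (isMG_slowRecovery H h0 h1) hπ h
  rw [Fin.sum_univ_two] at this
  linarith

lemma J_slowRecovery_le {H : ℕ} {p : ℝ} (h0 : 0 ≤ p) (h1 : p ≤ 1)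
    {π : Fin 2 → (Fin 1 → Fin 2) → ℝ} (hπ : IsPolicy (A := fun _ => Fin 2) π) :
    J (slowRecovery H p) 0 π ≤ H := by
  rw [J_slowRecovery H p hπ]
  calc _ ≤ ∑ _h ∈ Finset.range H, (1 : ℝ) := Finset.sum_le_sum fun h _ => by
        rw [stateDist_zero_eq h0 h1 hπ]
        linarith [stateDist_nonneg (isMG_slowRecovery H h0 h1) hπ h 1]
    _ = H := by simp

lemma J_slowRecovery_of_no_error {H : ℕ} {p : ℝ} (h0 : 0 ≤ p) (h1 : p ≤ 1)
    {π : Fin 2 → (Fin 1 → Fin 2) → ℝ} (hπ : IsPolicy (A := fun _ => Fin 2) π)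
    (hπ0 : π 0 (fun _ => 1) = 0) : J (slowRecovery H p) 0 π = H := by
  have key : ∀ h, stateDist (slowRecovery H p) π h 1 = 0 := by
    intro h
    induction h with
    | zero => simp [stateDist, slowRecovery]
    | succ h ih => rw [stateDist_slowRecovery_succ H p hπ, ih, hπ0]; ring
  rw [J_slowRecovery H p hπ]
  simp [stateDist_zero_eq h0 h1 hπ, key]

lemma dev_const_zero (σ : Fin 2 → (Fin 1 → Fin 2) → ℝ) (s : Fin 2) :
    dev (A := fun _ => Fin 2) σ 0 (fun _ _ => 0) s (fun _ => 1) = 0 := by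
  refine Finset.sum_eq_zero fun a _ => if_neg fun h => ?_
  simpa using congrFun h 0

lemma Vgo_slowRecovery_zero (H : ℕ) (p : ℝ) {π : Fin 2 → (Fin 1 → Fin 2) → ℝ}
    (hπ : IsPolicy (A := fun _ => Fin 2) π) (k : ℕ) :
    Vgo (slowRecovery H p) ((slowRecovery H p).r 0) π (k + 1) 0 =
      1 + π 0 (fun _ => 0) * Vgo (slowRecovery H p) ((slowRecovery H p).r 0) π k 0 +
        π 0 (fun _ => 1) * Vgo (slowRecovery H p) ((slowRecovery H p).r 0) π k 1 := by
  rw [Vgo]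
  beta_reduce
  rw [sum_jointAction]
  have := sum_policy hπ 0
  simp only [Fin.sum_univ_two, slowRecovery_T, slowRecovery_r, one_ne_zero, zero_ne_one, if_false,
    if_true, one_mul, zero_mul, add_zero, zero_add]
  linear_combination this

lemma Vgo_slowRecovery_one (H : ℕ) (p : ℝ) {π : Fin 2 → (Fin 1 → Fin 2) → ℝ}
    (hπ : IsPolicy (A := fun _ => Fin 2) π) (k : ℕ) :
    Vgo (slowRecovery H p) ((slowRecovery H p).r 0) π (k + 1) 1 =
      p * Vgo (slowRecovery H p) ((slowRecovery H p).r 0) π k 0 +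
        (1 - p) * Vgo (slowRecovery H p) ((slowRecovery H p).r 0) π k 1 := by
  rw [Vgo]
  beta_reduce
  rw [sum_jointAction]
  simp only [Fin.sum_univ_two, slowRecovery_T, slowRecovery_r, one_ne_zero, if_false, if_true,
    zero_add]
  rw [← add_mul, sum_policy hπ 1, one_mul]

lemma Vgo_slowRecovery_sub {H : ℕ} {p w : ℝ} (h0 : 0 ≤ p) (h1 : p ≤ 1) (hw : 0 ≤ w)
    (hpw : p * w = 1) {π : Fin 2 → (Fin 1 → Fin 2) → ℝ}
    (hπ : IsPolicy (A := fun _ => Fin 2) π) (k : ℕ) :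
    0 ≤ Vgo (slowRecovery H p) ((slowRecovery H p).r 0) π k 0 -
        Vgo (slowRecovery H p) ((slowRecovery H p).r 0) π k 1 ∧
      Vgo (slowRecovery H p) ((slowRecovery H p).r 0) π k 0 -
        Vgo (slowRecovery H p) ((slowRecovery H p).r 0) π k 1 ≤ w := by
  induction k with
  | zero => simpa [Vgo] using hw
  | succ k ih =>
    rw [Vgo_slowRecovery_zero H p hπ, Vgo_slowRecovery_one H p hπ]
    have hs := sum_policy hπ 0
    have he := (hπ 0).1 (fun _ => 1)
    have hg := (hπ 0).1 (fun _ => 0)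
    set x := Vgo (slowRecovery H p) ((slowRecovery H p).r 0) π k 0
    set y := Vgo (slowRecovery H p) ((slowRecovery H p).r 0) π k 1
    obtain ⟨ih0, ih1⟩ := ih
    have hrec : 1 + π 0 (fun _ => 0) * x + π 0 (fun _ => 1) * y - (p * x + (1 - p) * y) =
        1 + (π 0 (fun _ => 0) - p) * (x - y) := by linear_combination y * hs
    rw [hrec]
    constructor
    · nlinarith [mul_nonneg hg ih0, mul_le_mul_of_nonneg_left ih1 h0]
    · nlinarith [mul_nonneg he ih0, mul_le_mul_of_nonneg_left ih1 (sub_nonneg.2 h1)]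

lemma abs_Adv_slowRecovery_le {H : ℕ} {p w : ℝ} (h0 : 0 ≤ p) (h1 : p ≤ 1) (hw : 0 ≤ w)
    (hpw : p * w = 1) {π : Fin 2 → (Fin 1 → Fin 2) → ℝ}
    (hπ : IsPolicy (A := fun _ => Fin 2) π) (k : ℕ) (s : Fin 2) (a : Fin 1 → Fin 2) :
    |Adv (slowRecovery H p) ((slowRecovery H p).r 0) π k s a| ≤ w := by
  cases k with
  | zero => simpa [Adv, Qgo, Vgo] using hw
  | succ k =>
    obtain ⟨hd0, hd1⟩ := Vgo_slowRecovery_sub (H := H) h0 h1 hw hpw hπ k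
    have hs := sum_policy hπ 0
    have he := (hπ 0).1 (fun _ => 1)
    have hg := (hπ 0).1 (fun _ => 0)
    unfold Adv Qgo
    by_cases hs0 : s = 0
    · subst hs0
      rw [Vgo_slowRecovery_zero H p hπ]
      set x := Vgo (slowRecovery H p) ((slowRecovery H p).r 0) π k 0
      set y := Vgo (slowRecovery H p) ((slowRecovery H p).r 0) π k 1
      by_cases ha : a 0 = 0
      · have hadv : 1 + x - (1 + π 0 (fun _ => 0) * x + π 0 (fun _ => 1) * y) =
            π 0 (fun _ => 1) * (x - y) := by linear_combination -x * hs
        simp only [Fin.sum_univ_two, slowRecovery_T, slowRecovery_r, ha, if_true, one_ne_zero, if_false,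
          one_mul, zero_mul, add_zero]
        rw [hadv, abs_of_nonneg (mul_nonneg he hd0)]
        nlinarith
      · have ha1 : a 0 = 1 := by omega
        have hadv : 1 + y - (1 + π 0 (fun _ => 0) * x + π 0 (fun _ => 1) * y) =
            -(π 0 (fun _ => 0) * (x - y)) := by linear_combination -y * hs
        simp only [Fin.sum_univ_two, slowRecovery_T, slowRecovery_r, ha1, if_true, zero_ne_one, if_false,
          one_mul, zero_mul, zero_add]
        rw [hadv, abs_neg, abs_of_nonneg (mul_nonneg hg hd0)]
        nlinarith
    · have hs1 : s = 1 := by omega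
      subst hs1
      rw [Vgo_slowRecovery_one H p hπ]
      simpa [Fin.sum_univ_two, slowRecovery_T, slowRecovery_r] using hw

lemma le_stateDist_errPolicy {u H : ℕ} (hu : 2 ≤ u) (huH : u ≤ H) {ε : ℝ} (hε : 0 < ε)
    (hεH : ε * H ≤ 1 / 4) {h : ℕ} (hh : h ≤ H) :
    ε * u / (4 * H) * h ≤ stateDist (slowRecovery H (1 / u)) (errPolicy ε) h 1 := by
  have hu2 : (2 : ℝ) ≤ u := by exact_mod_cast hu
  have huH' : (u : ℝ) ≤ H := by exact_mod_cast huH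
  have hu0 : (0 : ℝ) < u := by linarith
  have hH0 : (0 : ℝ) < H := by linarith
  have hp0 : (0 : ℝ) ≤ 1 / u := by positivity
  have hp1 : (1 : ℝ) / u ≤ 1 / 2 := by gcongr
  have hεu : ε * u ≤ 1 / 4 := (mul_le_mul_of_nonneg_left huH' hε.le).trans hεH
  have hε1 : ε ≤ 1 / 8 := by nlinarith
  have hpol := isPolicy_errPolicy hε.le (by linarith : ε ≤ 1)
  induction h with
  | zero => simp [stateDist, slowRecovery]
  | succ h ih =>
    specialize ih (by omega)
    rw [stateDist_slowRecovery_succ H _ hpol, stateDist_zero_eq hp0 (by linarith) hpol]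
    set x := stateDist (slowRecovery H (1 / u)) (errPolicy ε) h 1
    have hh' : (h : ℝ) ≤ H := by exact_mod_cast (by omega : h ≤ H)
    have herr : errPolicy ε 0 (fun _ => 1) = ε := by simp [errPolicy]
    have hq : 0 ≤ 1 - 1 / (u : ℝ) - ε := by linarith
    have hmono := mul_le_mul_of_nonneg_left ih hq
    set y : ℝ := ε * u / (4 * H) * h with hy
    have hyε : y ≤ ε * u / 4 := by
      have : y = ε * u / 4 * (h / H) := by rw [hy]; field_simp
      rw [this]
      exact mul_le_of_le_one_right (by positivity) ((div_le_one hH0).2 hh')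
    have hinc : ε * u / (4 * H) ≤ ε / 4 := by
      rw [div_le_div_iff₀ (by positivity) (by norm_num)]
      nlinarith
    have hpy : 1 / (u : ℝ) * y ≤ ε / 4 := by
      calc 1 / (u : ℝ) * y ≤ 1 / u * (ε * u / 4) := mul_le_mul_of_nonneg_left hyε hp0
        _ = ε / 4 := by field_simp
    have hεy : ε * y ≤ ε / 16 := by nlinarith
    have hexp : ε * u / (4 * H) * ((h + 1 : ℕ) : ℝ) = y + ε * u / (4 * H) := by
      rw [hy]; push_cast; ring
    rw [herr, hexp]
    linarith

lemma J_errPolicy_le {u H : ℕ} (hu : 2 ≤ u) (huH : u ≤ H) {ε : ℝ} (hε : 0 < ε)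
    (hεH : ε * H ≤ 1 / 4) :
    J (slowRecovery H (1 / u)) 0 (errPolicy ε) ≤ H - 1 / 16 * ε * u * H := by
  have hu2 : (2 : ℝ) ≤ u := by exact_mod_cast hu
  have huH' : (u : ℝ) ≤ H := by exact_mod_cast huH
  have hH0 : (0 : ℝ) < H := by linarith
  have hp0 : (0 : ℝ) ≤ 1 / u := by positivity
  have hp1 : (1 : ℝ) / u ≤ 1 := (div_le_one (by linarith)).2 (by linarith)
  have hpol := isPolicy_errPolicy hε.le (by nlinarith : ε ≤ 1)
  have hsum : ∀ n : ℕ, ∑ h ∈ Finset.range n, (h : ℝ) = n * (n - 1) / 2 := by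
    intro n
    induction n with
    | zero => simp
    | succ n ih => rw [Finset.sum_range_succ, ih]; push_cast; ring
  rw [J_slowRecovery H _ hpol]
  calc _ ≤ ∑ h ∈ Finset.range H, (1 - ε * u / (4 * H) * (h : ℝ)) :=
        Finset.sum_le_sum fun h hh => by
          rw [stateDist_zero_eq hp0 hp1 hpol]
          linarith [le_stateDist_errPolicy hu huH hε hεH (Finset.mem_range.1 hh).le]
    _ = H - ε * u * (H - 1) / 8 := by
        rw [Finset.sum_sub_distrib, ← Finset.mul_sum, hsum]
        simp only [Finset.sum_const, Finset.card_range, nsmul_eq_mul, mul_one]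
        field_simp
        ring
    _ ≤ _ := by
        have : 0 ≤ ε * u * (H - 2) := by
          have : (0 : ℝ) ≤ H - 2 := by linarith
          positivity
        linarith

end SlowRecovery


/-- **BLADES regret gap lower bound.** There is a universal constant
`c > 0` such that for all integers `u ≥ 2`, horizons `H ≥ u`, and all `ε > 0` with
`ε·H ≤ 1/4`, there exist a finite Markov Game with horizon `H`, complete deviation
classes, an expert satisfying `u`-recoverability, and a learner with BLADES loss at
most `ε`, whose regret gap is at least `c·ε·u·H`. -/
theorem blades_regret_gap_lower_bound :
    ∃ c : ℝ, 0 < c ∧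
      ∀ (u H : ℕ), 2 ≤ u → u ≤ H →
      ∀ ε : ℝ, 0 < ε → ε * H ≤ 1 / 4 →
      ∃ (m : ℕ) (_ : 0 < m) (nS : ℕ) (nA : Fin m → ℕ)
        (G : MG m (Fin nS) (fun i => Fin (nA i)))
        (Φ : ∀ i : Fin m, Set (Fin nS → Fin (nA i) → Fin (nA i)))
        (σE σ : Fin nS → (∀ i, Fin (nA i)) → ℝ),
        IsMG G ∧ G.H = H ∧ (∀ i, Φ i = Set.univ) ∧
        IsPolicy σE ∧ IsPolicy σ ∧
        Recoverable G Φ σE (u : ℝ) ∧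
        (∀ i : Fin m, ∀ φ ∈ Φ i,
          (∑ s, dAvg G (dev σ i φ) s * tv (σE s) (σ s)) ≤ ε) ∧
        c * ε * u * H ≤ regret G σ Φ - regret G σE Φ := by
  refine ⟨1 / 16, by norm_num, fun u H hu huH ε hε hεH => ?_⟩
  have hu2 : (2 : ℝ) ≤ u := by exact_mod_cast hu
  have huH' : (u : ℝ) ≤ H := by exact_mod_cast huH
  have hp0 : (0 : ℝ) ≤ 1 / u := by positivity
  have hp1 : (1 : ℝ) / u ≤ 1 := (div_le_one (by linarith)).2 (by linarith)
  have hG := isMG_slowRecovery H hp0 hp1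
  have hE := isPolicy_errPolicy le_rfl zero_le_one
  have hL := isPolicy_errPolicy hε.le (by nlinarith : ε ≤ 1)
  have hE0 : J (slowRecovery H (1 / u)) 0 (errPolicy 0) = H :=
    J_slowRecovery_of_no_error hp0 hp1 hE (by simp [errPolicy])
  refine ⟨1, one_pos, 2, fun _ => 2, slowRecovery H (1 / u), fun _ => Set.univ, errPolicy 0,
    errPolicy ε, hG, rfl, fun _ => rfl, hE, hL, ?_, ?_, ?_⟩
  · intro i φ _ k _ s a
    obtain rfl : i = 0 := Subsingleton.elim _ _
    exact abs_Adv_slowRecovery_le hp0 hp1 (by linarith) (by field_simp) (hE.dev 0 φ) k s a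
  · intro i φ _
    simp only [tv_errPolicy hε.le]
    rw [← Finset.sum_mul, sum_dAvg hG (by simp only [slowRecovery]; omega) (hL.dev i φ), one_mul]
  · have hexpert : regret (slowRecovery H (1 / u)) (errPolicy 0) (fun _ => Set.univ) ≤ 0 := by
      refine ciSup_le fun i => ?_
      obtain rfl : i = 0 := Subsingleton.elim _ _
      refine Real.iSup_le (fun φ => ?_) le_rfl
      rw [hE0]
      linarith [J_slowRecovery_le (H := H) hp0 hp1 (hE.dev 0 φ.1)]
    have hlearner : H - J (slowRecovery H (1 / u)) 0 (errPolicy ε) ≤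
        regret (slowRecovery H (1 / u)) (errPolicy ε) (fun _ => Set.univ) := by
      refine le_trans ?_ (le_ciSup (Set.finite_range _).bddAbove (0 : Fin 1))
      refine le_trans (le_of_eq ?_)
        (le_ciSup (Set.finite_range _).bddAbove ⟨fun _ _ => 0, Set.mem_univ _⟩)
      rw [J_slowRecovery_of_no_error hp0 hp1 (hL.dev 0 fun _ _ => 0) (dev_const_zero _ 0)]
    linarith [J_errPolicy_le hu huH hε hεH]

end MAIL
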